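/- arXiv:2407.19146 — 6 statements merged into one kernel-verified Lean document; each statement's English description precedes it below -/
import Mathlib

section
/- Let T > 0, b ≥ 0, β ∈ (0,1], p > 0 and R > 0, and set k := ⌊1/β⌋. There exist constants c > 0 and τ₀ ∈ (0,1), depending only on b, β, p, T and R, such that the following holds. Let N ≥ 1 be an integer with τ := T/N ≤ τ₀, set t_j := jτ and ℓ_τ := |log τ|, let a ≥ 0, and let φ¹, …, φᴺ be real numbers with 0 ≤ φⁿ ≤ R for all 1 ≤ n ≤ N. If φⁿ ≤ a t_n^{−1} ℓ_τ^p + b τ Σ_{j=1}^{n} t_{n−j+1}^{β−1} φʲ for all 1 ≤ n ≤ N, then φⁿ ≤ c a t_n^{−1} ℓ_τ^{p+k} for all 1 ≤ n ≤ N. -/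
open Real Finset

lemma dgl_reflect (f : ℕ → ℝ) (n : ℕ) :
    ∑ j ∈ Finset.Icc 1 n, f (n - j + 1) = ∑ j ∈ Finset.Icc 1 n, f j := by
  refine Finset.sum_nbij' (fun j => n - j + 1) (fun j => n - j + 1) ?_ ?_ ?_ ?_ ?_
  · intro j hj
    simp only [Finset.mem_Icc] at *
    omega
  · intro j hj
    simp only [Finset.mem_Icc] at *
    omega
  · intro j hj
    simp only [Finset.mem_Icc] at *
    omega
  · intro j hj
    simp only [Finset.mem_Icc] at *
    omega
  · intro j hj
    rfl

lemma dgl_power_sum1 (γ : ℝ) (h0 : 0 < γ) (h1 : γ ≤ 1) (n : ℕ) :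
    ∑ j ∈ Finset.Icc 1 n, (j : ℝ) ^ (γ - 1) ≤ (n : ℝ) ^ γ / γ := by
  induction n with
  | zero => simp [Real.zero_rpow h0.ne']
  | succ n ih =>
    rw [Finset.sum_Icc_succ_top (by omega)]
    have hx : (0 : ℝ) < ((n + 1 : ℕ) : ℝ) := by positivity
    set x : ℝ := ((n + 1 : ℕ) : ℝ) with hxdef
    have hn : (n : ℝ) = x * (1 + (-(1 / x))) := by
      field_simp
      rw [hxdef]; push_cast; ring
    have h1x : -1 ≤ -(1 / x) := by
      have : 1 ≤ x := by rw [hxdef]; push_cast; linarith [Nat.cast_nonneg (α := ℝ) n]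
      have : 1 / x ≤ 1 := by rw [div_le_one hx]; exact this
      linarith
    have hB := rpow_one_add_le_one_add_mul_self h1x h0.le h1
    have hnγ : (n : ℝ) ^ γ ≤ x ^ γ * (1 + γ * (-(1 / x))) := by
      rw [hn, Real.mul_rpow hx.le (by linarith)]
      gcongr
    have hxx : x ^ (γ - 1) = x ^ γ / x := by rw [Real.rpow_sub_one hx.ne']
    calc _ ≤ (n : ℝ) ^ γ / γ + x ^ (γ - 1) := by gcongr
      _ ≤ (x ^ γ * (1 + γ * (-(1 / x)))) / γ + x ^ γ / x := by rw [hxx]; gcongr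
      _ = x ^ γ / γ := by field_simp; ring

lemma dgl_power_sum (γ τ : ℝ) (h0 : 0 < γ) (h1 : γ ≤ 1) (hτ : 0 < τ) (n : ℕ) :
    τ * ∑ j ∈ Finset.Icc 1 n, ((j : ℝ) * τ) ^ (γ - 1) ≤ ((n : ℝ) * τ) ^ γ / γ := by
  have h := dgl_power_sum1 γ h0 h1 n
  have e : ∑ j ∈ Finset.Icc 1 n, ((j : ℝ) * τ) ^ (γ - 1)
      = (∑ j ∈ Finset.Icc 1 n, (j : ℝ) ^ (γ - 1)) * τ ^ (γ - 1) := by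
    rw [Finset.sum_mul]
    refine Finset.sum_congr rfl fun j _ => ?_
    rw [Real.mul_rpow (by positivity) hτ.le]
  rw [e, Real.mul_rpow (by positivity) hτ.le, Real.rpow_sub_one hτ.ne']
  calc _ = (∑ j ∈ Finset.Icc 1 n, (j : ℝ) ^ (γ - 1)) * τ ^ γ := by field_simp
    _ ≤ ((n : ℝ) ^ γ / γ) * τ ^ γ := by gcongr
    _ = _ := by ring

lemma dgl_geom (τ lam : ℝ) (hτ : 0 < τ) (hl : 0 < lam) (n : ℕ) :
    τ * ∑ j ∈ Finset.Icc 1 n, (1 + lam * τ) ^ j ≤ (1 + lam * τ) ^ n * (τ + 1 / lam) := by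
  induction n with
  | zero => simp; positivity
  | succ n ih =>
    rw [Finset.sum_Icc_succ_top (by omega), mul_add]
    calc _ ≤ (1 + lam * τ) ^ n * (τ + 1 / lam) + τ * (1 + lam * τ) ^ (n + 1) := by gcongr
      _ = _ := by rw [pow_succ]; field_simp; ring

lemma dgl_base (β x y z : ℝ) (h1 : β ≤ 1) (h0 : 0 < β) (hx : 0 < x) (hy : 0 < y) (hz : 0 < z)
    (hxyz : z ≤ x + y) : 1 ≤ z ^ (β - 1) * (x ^ (1 - β) + y ^ (1 - β)) := by
  have h : z ^ (1 - β) ≤ x ^ (1 - β) + y ^ (1 - β) :=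
    (Real.rpow_le_rpow hz.le hxyz (by linarith)).trans
      (Real.rpow_add_le_add_rpow hx.le hy.le (by linarith) (by linarith))
  calc (1 : ℝ) = z ^ (β - 1) * z ^ (1 - β) := by
        rw [← Real.rpow_add hz]; simp
    _ ≤ _ := by gcongr

lemma dgl_inv (β x : ℝ) (hx : 0 < x) : x ^ (β - 1) * x ^ (1 - β) = 1 := by
  rw [← Real.rpow_add hx]; simp

lemma dgl_conv (β x y z : ℝ) (h1 : β ≤ 1) (h0 : 0 < β) (hx : 0 < x) (hy : 0 < y) (hz : 0 < z)
    (hxyz : z ≤ x + y) :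
    x ^ (β - 1) * y ^ (β - 1) ≤ z ^ (β - 1) * (x ^ (β - 1) + y ^ (β - 1)) := by
  have h := dgl_base β x y z h1 h0 hx hy hz hxyz
  have ex := dgl_inv β x hx
  have ey := dgl_inv β y hy
  calc x ^ (β - 1) * y ^ (β - 1) = x ^ (β - 1) * y ^ (β - 1) * 1 := by ring
    _ ≤ x ^ (β - 1) * y ^ (β - 1) * (z ^ (β - 1) * (x ^ (1 - β) + y ^ (1 - β))) := by gcongr
    _ = z ^ (β - 1) * ((x ^ (β - 1) * x ^ (1 - β)) * y ^ (β - 1)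
          + x ^ (β - 1) * (y ^ (β - 1) * y ^ (1 - β))) := by ring
    _ = _ := by rw [ex, ey]; ring

lemma dgl_conv2 (β x y z : ℝ) (h1 : β ≤ 1) (h0 : 0 < β) (hx : 0 < x) (hy : 0 < y) (hz : 0 < z)
    (hxyz : z ≤ x + y) :
    x ^ (β - 1) * y⁻¹ ≤ z ^ (β - 1) * (2 * y⁻¹ + x⁻¹) := by
  have h := dgl_base β x y z h1 h0 hx hy hz hxyz
  have ex := dgl_inv β x hx
  have key : x ^ (β - 1) * (y ^ (1 - β) * y⁻¹) ≤ y⁻¹ + x⁻¹ := by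
    have hX : 0 < x⁻¹ := by positivity
    have hY : 0 < y⁻¹ := by positivity
    have h2 := Real.geom_mean_le_arith_mean2_weighted (w₁ := 1 - β) (w₂ := β) (by linarith) h0.le
      hX.le hY.le (by ring)
    have e1 : x ^ (β - 1) = x⁻¹ ^ (1 - β) := by
      rw [Real.inv_rpow hx.le, ← Real.rpow_neg hx.le]; congr 1; ring
    have e2 : y ^ (1 - β) * y⁻¹ = y⁻¹ ^ β := by
      rw [Real.inv_rpow hy.le, ← Real.rpow_neg hy.le, ← Real.rpow_neg_one, ← Real.rpow_add hy]
      congr 1; ring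
    rw [e1, e2]
    nlinarith
  calc x ^ (β - 1) * y⁻¹ = x ^ (β - 1) * y⁻¹ * 1 := by ring
    _ ≤ x ^ (β - 1) * y⁻¹ * (z ^ (β - 1) * (x ^ (1 - β) + y ^ (1 - β))) := by gcongr
    _ = z ^ (β - 1) * ((x ^ (β - 1) * x ^ (1 - β)) * y⁻¹
          + x ^ (β - 1) * (y ^ (1 - β) * y⁻¹)) := by ring
    _ ≤ z ^ (β - 1) * (1 * y⁻¹ + (y⁻¹ + x⁻¹)) := by rw [ex]; gcongr
    _ = _ := by ring

lemma dgl_split (β δ x : ℝ) (h1 : β ≤ 1) (h0 : 0 < β) (hx : 0 < x) (hδ : 0 < δ) :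
    x ^ (β - 1) ≤ δ ^ (β - 1) + δ ^ (β / 2) * x ^ (β / 2 - 1) := by
  rcases le_total δ x with h | h
  · have : x ^ (β - 1) ≤ δ ^ (β - 1) := Real.rpow_le_rpow_of_nonpos hδ h (by linarith)
    have : 0 ≤ δ ^ (β / 2) * x ^ (β / 2 - 1) := by positivity
    linarith
  · have e : x ^ (β - 1) = x ^ (β / 2) * x ^ (β / 2 - 1) := by
      rw [← Real.rpow_add hx]; congr 1; ring
    have : x ^ (β / 2) ≤ δ ^ (β / 2) := Real.rpow_le_rpow hx.le h (by linarith)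
    have h3 : x ^ (β - 1) ≤ δ ^ (β / 2) * x ^ (β / 2 - 1) := by rw [e]; gcongr
    have : 0 ≤ δ ^ (β - 1) := by positivity
    linarith

lemma dgl_K1 (β τ : ℝ) (h1 : β ≤ 1) (h0 : 0 < β) (hτ : 0 < τ) (n : ℕ) (hn : 1 ≤ n) :
    τ * ∑ j ∈ Finset.Icc 1 n, (((n - j + 1 : ℕ) : ℝ) * τ) ^ (β - 1) * ((j : ℝ) * τ)⁻¹
      ≤ 3 * ((n : ℝ) * τ) ^ (β - 1) * (1 + Real.log n) := by
  have hn' : (0 : ℝ) < n := by exact_mod_cast hn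
  have hterm : ∀ j ∈ Finset.Icc 1 n,
      (((n - j + 1 : ℕ) : ℝ) * τ) ^ (β - 1) * ((j : ℝ) * τ)⁻¹ ≤
      ((n : ℝ) * τ) ^ (β - 1) * (2 * ((j : ℝ) * τ)⁻¹ + (((n - j + 1 : ℕ) : ℝ) * τ)⁻¹) := by
    intro j hj
    simp only [Finset.mem_Icc] at hj
    have hj' : (0 : ℝ) < j := by exact_mod_cast hj.1
    refine dgl_conv2 β _ _ _ h1 h0 (by positivity) (by positivity) (by positivity) ?_
    rw [← add_mul]
    gcongr
    have : n ≤ (n - j + 1) + j := by omega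
    exact_mod_cast this
  have hH : ∑ j ∈ Finset.Icc 1 n, ((j : ℝ) * τ)⁻¹ = τ⁻¹ * ∑ j ∈ Finset.Icc 1 n, (j : ℝ)⁻¹ := by
    rw [Finset.mul_sum]
    refine Finset.sum_congr rfl fun j _ => ?_
    rw [mul_inv]; ring
  have hlog : ∑ j ∈ Finset.Icc 1 n, (j : ℝ)⁻¹ ≤ 1 + Real.log n := by
    have := harmonic_le_one_add_log n
    rw [harmonic_eq_sum_Icc] at this
    push_cast at this
    exact this
  have hr := dgl_reflect (fun i => ((i : ℝ) * τ)⁻¹) n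
  calc _ ≤ τ * ∑ j ∈ Finset.Icc 1 n, ((n : ℝ) * τ) ^ (β - 1) *
        (2 * ((j : ℝ) * τ)⁻¹ + (((n - j + 1 : ℕ) : ℝ) * τ)⁻¹) := by
        exact mul_le_mul_of_nonneg_left (Finset.sum_le_sum hterm) hτ.le
    _ = 3 * ((n : ℝ) * τ) ^ (β - 1) * ∑ j ∈ Finset.Icc 1 n, (j : ℝ)⁻¹ := by
        rw [← Finset.mul_sum, Finset.sum_add_distrib, ← Finset.mul_sum, hr, hH]
        field_simp; ring
    _ ≤ _ := by gcongr

lemma dgl_K2 (β τ lam δ T : ℝ) (h1 : β ≤ 1) (h0 : 0 < β) (hτ : 0 < τ) (hl : 0 < lam)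
    (hδ : 0 < δ) (n : ℕ) (hn : 1 ≤ n) (hT : (n : ℝ) * τ ≤ T) :
    τ * ∑ j ∈ Finset.Icc 1 n, (((n - j + 1 : ℕ) : ℝ) * τ) ^ (β - 1) *
        (((j : ℝ) * τ) ^ (β - 1) * (1 + lam * τ) ^ j)
      ≤ ((n : ℝ) * τ) ^ (β - 1) * (1 + lam * τ) ^ n *
        (2 * δ ^ (β - 1) * (τ + 1 / lam) + 2 * δ ^ (β / 2) * (T ^ (β / 2) / (β / 2))) := by
  have hn' : (0 : ℝ) < n := by exact_mod_cast hn
  set ρ := 1 + lam * τ with hρ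
  have hρ1 : 1 ≤ ρ := by rw [hρ]; nlinarith [mul_pos hl hτ]
  have hterm : ∀ j ∈ Finset.Icc 1 n,
      (((n - j + 1 : ℕ) : ℝ) * τ) ^ (β - 1) * (((j : ℝ) * τ) ^ (β - 1) * ρ ^ j) ≤
      ((n : ℝ) * τ) ^ (β - 1) * (2 * δ ^ (β - 1) * ρ ^ j + δ ^ (β / 2) * ρ ^ n *
        ((((n - j + 1 : ℕ) : ℝ) * τ) ^ (β / 2 - 1) + ((j : ℝ) * τ) ^ (β / 2 - 1))) := by
    intro j hj
    simp only [Finset.mem_Icc] at hj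
    have hj' : (0 : ℝ) < j := by exact_mod_cast hj.1
    have hx : 0 < ((n - j + 1 : ℕ) : ℝ) * τ := by positivity
    have hy : 0 < (j : ℝ) * τ := by positivity
    have hz : 0 < (n : ℝ) * τ := by positivity
    have hxyz : (n : ℝ) * τ ≤ ((n - j + 1 : ℕ) : ℝ) * τ + (j : ℝ) * τ := by
      rw [← add_mul]
      gcongr
      have : n ≤ (n - j + 1) + j := by omega
      exact_mod_cast this
    generalize ((n - j + 1 : ℕ) : ℝ) * τ = x at *
    generalize (j : ℝ) * τ = y at *
    generalize (n : ℝ) * τ = z at *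
    have hc := dgl_conv β x y z h1 h0 hx hy hz hxyz
    have s1 := dgl_split β δ x h1 h0 hx hδ
    have s2 := dgl_split β δ y h1 h0 hy hδ
    have hpow : ρ ^ j ≤ ρ ^ n := pow_le_pow_right₀ hρ1 hj.2
    have hρj : 0 < ρ ^ j := by positivity
    calc x ^ (β - 1) * (y ^ (β - 1) * ρ ^ j) = x ^ (β - 1) * y ^ (β - 1) * ρ ^ j := by ring
      _ ≤ z ^ (β - 1) * (x ^ (β - 1) + y ^ (β - 1)) * ρ ^ j := by gcongr
      _ ≤ z ^ (β - 1) * ((δ ^ (β - 1) + δ ^ (β / 2) * x ^ (β / 2 - 1))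
            + (δ ^ (β - 1) + δ ^ (β / 2) * y ^ (β / 2 - 1))) * ρ ^ j := by gcongr
      _ = z ^ (β - 1) * (2 * δ ^ (β - 1) * ρ ^ j + δ ^ (β / 2) * ρ ^ j *
            (x ^ (β / 2 - 1) + y ^ (β / 2 - 1))) := by ring
      _ ≤ _ := by gcongr
  have hr := dgl_reflect (fun i => ((i : ℝ) * τ) ^ (β / 2 - 1)) n
  have hg := dgl_geom τ lam hτ hl n
  rw [← hρ] at hg
  have hp := dgl_power_sum (β / 2) τ (by linarith) (by linarith) hτ n
  have hp2 : ((n : ℝ) * τ) ^ (β / 2) / (β / 2) ≤ T ^ (β / 2) / (β / 2) := by gcongr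
  calc _ ≤ τ * ∑ j ∈ Finset.Icc 1 n, ((n : ℝ) * τ) ^ (β - 1) *
        (2 * δ ^ (β - 1) * ρ ^ j + δ ^ (β / 2) * ρ ^ n *
        ((((n - j + 1 : ℕ) : ℝ) * τ) ^ (β / 2 - 1) + ((j : ℝ) * τ) ^ (β / 2 - 1))) := by
        exact mul_le_mul_of_nonneg_left (Finset.sum_le_sum hterm) hτ.le
    _ = ((n : ℝ) * τ) ^ (β - 1) * (2 * δ ^ (β - 1) * (τ * ∑ j ∈ Finset.Icc 1 n, ρ ^ j)
          + 2 * δ ^ (β / 2) * ρ ^ n *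
            (τ * ∑ j ∈ Finset.Icc 1 n, ((j : ℝ) * τ) ^ (β / 2 - 1))) := by
        rw [← Finset.mul_sum, Finset.sum_add_distrib, ← Finset.mul_sum, ← Finset.mul_sum,
          Finset.sum_add_distrib, hr]
        ring
    _ ≤ ((n : ℝ) * τ) ^ (β - 1) * (2 * δ ^ (β - 1) * (ρ ^ n * (τ + 1 / lam))
          + 2 * δ ^ (β / 2) * ρ ^ n * (T ^ (β / 2) / (β / 2))) := by
        gcongr
        exact hp.trans hp2
    _ = _ := by ring

/-- Comparison principle. -/
lemma dgl_compare (N : ℕ) (κ : ℝ) (w s φ ψ : ℕ → ℝ) (hκ : 0 ≤ κ) (hw : ∀ i, 0 ≤ w i)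
    (hκw : κ * w 1 < 1)
    (hφ : ∀ n, 1 ≤ n → n ≤ N → φ n ≤ s n + κ * ∑ j ∈ Finset.Icc 1 n, w (n - j + 1) * φ j)
    (hψ : ∀ n, 1 ≤ n → n ≤ N → s n + κ * ∑ j ∈ Finset.Icc 1 n, w (n - j + 1) * ψ j ≤ ψ n) :
    ∀ n, 1 ≤ n → n ≤ N → φ n ≤ ψ n := by
  intro n
  induction n using Nat.strong_induction_on with
  | _ n ih =>
    intro h1 hN
    obtain ⟨m, rfl⟩ : ∃ m, n = m + 1 := ⟨n - 1, by omega⟩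
    have a := hφ _ h1 hN
    have b := hψ _ h1 hN
    rw [Finset.sum_Icc_succ_top (by omega)] at a b
    have hs : ∑ j ∈ Finset.Icc 1 m, w (m + 1 - j + 1) * φ j
        ≤ ∑ j ∈ Finset.Icc 1 m, w (m + 1 - j + 1) * ψ j := by
      refine Finset.sum_le_sum fun j hj => ?_
      simp only [Finset.mem_Icc] at hj
      exact mul_le_mul_of_nonneg_left (ih j (by omega) hj.1 (by omega)) (hw _)
    have hs' := mul_le_mul_of_nonneg_left hs hκ
    simp only [Nat.sub_self, Nat.zero_add] at a b
    by_contra! hlt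
    nlinarith [mul_pos (sub_pos.2 hκw) (sub_pos.2 hlt)]

/-- Discrete Gronwall inequality with logarithmic factors (Lemma 3.8). -/
theorem discrete_gronwall_log (T b β p R : ℝ) (hT : 0 < T) (hb : 0 ≤ b)
    (hβ : β ∈ Set.Ioc (0:ℝ) 1) (hp : 0 < p) (hR : 0 < R) :
    ∃ c > (0:ℝ), ∃ τ₀ ∈ Set.Ioo (0:ℝ) 1,
      ∀ N : ℕ, 1 ≤ N → T / N ≤ τ₀ →
      ∀ a : ℝ, 0 ≤ a → ∀ φ : ℕ → ℝ,
      (∀ n, 1 ≤ n → n ≤ N → 0 ≤ φ n ∧ φ n ≤ R) →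
      (∀ n, 1 ≤ n → n ≤ N →
        φ n ≤ a * ((n : ℝ) * (T / N))⁻¹ * |Real.log (T / N)| ^ p
          + b * (T / N) * ∑ j ∈ Finset.Icc 1 n,
              (((n - j + 1 : ℕ) : ℝ) * (T / N)) ^ (β - 1) * φ j) →
      ∀ n, 1 ≤ n → n ≤ N →
        φ n ≤ c * a * ((n : ℝ) * (T / N))⁻¹
          * |Real.log (T / N)| ^ (p + (Nat.floor (1 / β) : ℝ)) := by
  obtain ⟨h0, h1⟩ := hβ
  obtain ⟨G, hG⟩ : ∃ G, G = T ^ (β / 2) / (β / 2) := ⟨_, rfl⟩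
  have hGpos : 0 < G := by rw [hG]; positivity
  obtain ⟨δ, hδ, hδe⟩ : ∃ δ : ℝ, 0 < δ ∧ δ ^ (β / 2) = 1 / (8 * (b + 1) * (G + 1)) := by
    refine ⟨(1 / (8 * (b + 1) * (G + 1))) ^ (β / 2)⁻¹, by positivity, ?_⟩
    rw [← Real.rpow_mul (by positivity), inv_mul_cancel₀ (by positivity), Real.rpow_one]
  obtain ⟨D, hD⟩ : ∃ D, D = δ ^ (β - 1) := ⟨_, rfl⟩
  have hDpos : 0 < D := by rw [hD]; positivity
  obtain ⟨lam, hlam⟩ : ∃ lam, lam = 16 * (b + 1) * D := ⟨_, rfl⟩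
  have hl : 0 < lam := by rw [hlam]; positivity
  obtain ⟨C1, hC1⟩ : ∃ C1, C1 = b * 3 * (2 + |Real.log T|) := ⟨_, rfl⟩
  have hC1n : 0 ≤ C1 := by rw [hC1]; positivity
  refine ⟨1 + 2 * C1 * T ^ β * Real.exp (lam * T), by positivity,
    min (1 / lam) (Real.exp (-1)), ⟨by positivity, ?_⟩, ?_⟩
  · exact (min_le_right _ _).trans_lt (by simp)
  intro N hN hτ₀ a ha φ _ hφ
  have hN' : (0 : ℝ) < N := by exact_mod_cast hN
  obtain ⟨τ, hτdef⟩ : ∃ τ, τ = T / N := ⟨_, rfl⟩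
  have hτ : 0 < τ := by rw [hτdef]; positivity
  have hNτ : (N : ℝ) * τ = T := by rw [hτdef]; field_simp
  simp only [← hτdef] at hτ₀ hφ ⊢
  have hτ1 : τ ≤ 1 / lam := hτ₀.trans (min_le_left _ _)
  have hτ2 : τ ≤ Real.exp (-1) := hτ₀.trans (min_le_right _ _)
  have hlogτ : Real.log τ ≤ -1 := by
    rw [Real.log_le_iff_le_exp hτ]; exact hτ2
  obtain ⟨L, hL⟩ : ∃ L, L = |Real.log τ| := ⟨_, rfl⟩
  have hLe : L = -Real.log τ := by rw [hL]; exact abs_of_nonpos (by linarith)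
  have hL1 : 1 ≤ L := by linarith
  simp only [← hL] at hφ ⊢
  have hnT : ∀ n : ℕ, n ≤ N → (n : ℝ) * τ ≤ T := by
    intro n hn
    rw [← hNτ]; gcongr
  have hlogn : ∀ n : ℕ, 1 ≤ n → n ≤ N → 1 + Real.log n ≤ (2 + |Real.log T|) * L := by
    intro n hn hnN
    have e : Real.log N = Real.log T + L := by
      rw [← hNτ, Real.log_mul hN'.ne' hτ.ne', hLe]; ring
    have : Real.log n ≤ Real.log N :=
      Real.log_le_log (by exact_mod_cast hn) (by exact_mod_cast hnN)
    nlinarith [le_abs_self (Real.log T), abs_nonneg (Real.log T)]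
  -- bound for the singular part
  have hA : ∀ n : ℕ, 1 ≤ n → n ≤ N →
      b * τ * ∑ j ∈ Finset.Icc 1 n, (((n - j + 1 : ℕ) : ℝ) * τ) ^ (β - 1) * ((j : ℝ) * τ)⁻¹
        ≤ C1 * L * ((n : ℝ) * τ) ^ (β - 1) := by
    intro n hn hnN
    have hk := dgl_K1 β τ h1 h0 hτ n hn
    calc _ = b * (τ * ∑ j ∈ Finset.Icc 1 n,
          (((n - j + 1 : ℕ) : ℝ) * τ) ^ (β - 1) * ((j : ℝ) * τ)⁻¹) := by ring
      _ ≤ b * (3 * ((n : ℝ) * τ) ^ (β - 1) * (1 + Real.log n)) := by gcongr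
      _ ≤ b * (3 * ((n : ℝ) * τ) ^ (β - 1) * ((2 + |Real.log T|) * L)) := by
          gcongr
          exact hlogn n hn hnN
      _ = _ := by rw [hC1]; ring
  have hsmall : b * (2 * D * (τ + 1 / lam) + 2 * δ ^ (β / 2) * G) ≤ 1 / 2 := by
    have q1 : b * (2 * D * (τ + 1 / lam)) ≤ 1 / 4 := by
      calc b * (2 * D * (τ + 1 / lam)) ≤ (b + 1) * (2 * D * (1 / lam + 1 / lam)) := by
            gcongr; linarith
        _ = 1 / 4 := by rw [hlam]; field_simp; norm_num
    have q2 : b * (2 * δ ^ (β / 2) * G) ≤ 1 / 4 := by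
      rw [hδe]
      calc b * (2 * (1 / (8 * (b + 1) * (G + 1))) * G)
          ≤ (b + 1) * (2 * (1 / (8 * (b + 1) * (G + 1))) * (G + 1)) := by
            gcongr <;> linarith
        _ = 1 / 4 := by field_simp; norm_num
    linarith
  have hB : ∀ n : ℕ, 1 ≤ n → n ≤ N →
      b * τ * ∑ j ∈ Finset.Icc 1 n, (((n - j + 1 : ℕ) : ℝ) * τ) ^ (β - 1) *
        (((j : ℝ) * τ) ^ (β - 1) * (1 + lam * τ) ^ j)
        ≤ 1 / 2 * (((n : ℝ) * τ) ^ (β - 1) * (1 + lam * τ) ^ n) := by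
    intro n hn hnN
    have hk := dgl_K2 β τ lam δ T h1 h0 hτ hl hδ n hn (hnT n hnN)
    rw [← hG, ← hD] at hk
    calc _ = b * (τ * ∑ j ∈ Finset.Icc 1 n, (((n - j + 1 : ℕ) : ℝ) * τ) ^ (β - 1) *
        (((j : ℝ) * τ) ^ (β - 1) * (1 + lam * τ) ^ j)) := by ring
      _ ≤ b * (((n : ℝ) * τ) ^ (β - 1) * (1 + lam * τ) ^ n *
        (2 * D * (τ + 1 / lam) + 2 * δ ^ (β / 2) * G)) := by gcongr
      _ = (b * (2 * D * (τ + 1 / lam) + 2 * δ ^ (β / 2) * G)) *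
            (((n : ℝ) * τ) ^ (β - 1) * (1 + lam * τ) ^ n) := by ring
      _ ≤ _ := by gcongr
  have hdiag : b * τ * (((1 : ℕ) : ℝ) * τ) ^ (β - 1) < 1 := by
    have h := hB 1 le_rfl hN
    simp only [Finset.Icc_self, Finset.sum_singleton, Nat.sub_self, Nat.zero_add] at h
    have hpos : 0 < (((1 : ℕ) : ℝ) * τ) ^ (β - 1) * (1 + lam * τ) ^ 1 := by positivity
    rw [← mul_assoc (b * τ)] at h
    have := le_of_mul_le_mul_right h hpos
    exact this.trans_lt (by norm_num)
  have hcmp := dgl_compare N (b * τ) (fun i => ((i : ℝ) * τ) ^ (β - 1))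
    (fun n => a * ((n : ℝ) * τ)⁻¹ * L ^ p) φ
    (fun n => a * L ^ p * (((n : ℝ) * τ)⁻¹ +
      2 * C1 * L * (((n : ℝ) * τ) ^ (β - 1) * (1 + lam * τ) ^ n)))
    (by positivity) (fun i => by positivity) hdiag hφ (by
      intro n hn hnN
      have hn' : (0 : ℝ) < n := by exact_mod_cast hn
      have hα := hA n hn hnN
      have hβ' := hB n hn hnN
      have hρ : 1 ≤ (1 + lam * τ) ^ n := one_le_pow₀ (by nlinarith [mul_pos hl hτ])
      have e : ∑ j ∈ Finset.Icc 1 n, (((n - j + 1 : ℕ) : ℝ) * τ) ^ (β - 1) *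
          (a * L ^ p * (((j : ℝ) * τ)⁻¹ +
            2 * C1 * L * (((j : ℝ) * τ) ^ (β - 1) * (1 + lam * τ) ^ j)))
          = a * L ^ p * (∑ j ∈ Finset.Icc 1 n,
              (((n - j + 1 : ℕ) : ℝ) * τ) ^ (β - 1) * ((j : ℝ) * τ)⁻¹
            + 2 * C1 * L * ∑ j ∈ Finset.Icc 1 n, (((n - j + 1 : ℕ) : ℝ) * τ) ^ (β - 1) *
              (((j : ℝ) * τ) ^ (β - 1) * (1 + lam * τ) ^ j)) := by
        rw [Finset.mul_sum, ← Finset.sum_add_distrib, Finset.mul_sum]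
        refine Finset.sum_congr rfl fun j _ => ?_
        ring
      rw [e]
      generalize ∑ j ∈ Finset.Icc 1 n,
              (((n - j + 1 : ℕ) : ℝ) * τ) ^ (β - 1) * ((j : ℝ) * τ)⁻¹ = S1 at *
      generalize ∑ j ∈ Finset.Icc 1 n, (((n - j + 1 : ℕ) : ℝ) * τ) ^ (β - 1) *
              (((j : ℝ) * τ) ^ (β - 1) * (1 + lam * τ) ^ j) = S2 at *
      calc a * ((n : ℝ) * τ)⁻¹ * L ^ p + b * τ * (a * L ^ p * (S1 + 2 * C1 * L * S2))
          = a * L ^ p * (((n : ℝ) * τ)⁻¹ + (b * τ * S1 + 2 * C1 * L * (b * τ * S2))) := by ring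
        _ ≤ a * L ^ p * (((n : ℝ) * τ)⁻¹ + (C1 * L * (((n : ℝ) * τ) ^ (β - 1) * 1)
            + 2 * C1 * L * (1 / 2 * (((n : ℝ) * τ) ^ (β - 1) * (1 + lam * τ) ^ n)))) := by
            rw [mul_one]; gcongr
        _ ≤ a * L ^ p * (((n : ℝ) * τ)⁻¹
            + (C1 * L * (((n : ℝ) * τ) ^ (β - 1) * (1 + lam * τ) ^ n)
            + 2 * C1 * L * (1 / 2 * (((n : ℝ) * τ) ^ (β - 1) * (1 + lam * τ) ^ n)))) := by
            gcongr
        _ = _ := by ring)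
  intro n hn hnN
  have hn' : (0 : ℝ) < n := by exact_mod_cast hn
  have hx : 0 < (n : ℝ) * τ := by positivity
  refine (hcmp n hn hnN).trans ?_
  have hρ : (1 + lam * τ) ^ n ≤ Real.exp (lam * T) := by
    calc (1 + lam * τ) ^ n ≤ (Real.exp (lam * τ)) ^ n := by
          gcongr; linarith [Real.add_one_le_exp (lam * τ)]
      _ = Real.exp (lam * ((n : ℝ) * τ)) := by rw [← Real.exp_nat_mul]; congr 1; ring
      _ ≤ _ := by gcongr; exact hnT n hnN
  have hfl : (1 : ℝ) ≤ (Nat.floor (1 / β) : ℝ) := by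
    have : 1 ≤ Nat.floor (1 / β) := by
      apply Nat.le_floor
      rw [Nat.cast_one, le_div_iff₀ h0]; linarith
    exact_mod_cast this
  have hLp : L ^ p * L ≤ L ^ (p + (Nat.floor (1 / β) : ℝ)) := by
    rw [← Real.rpow_add_one (by positivity)]
    exact Real.rpow_le_rpow_of_exponent_le hL1 (by linarith)
  have hTb : ((n : ℝ) * τ) ^ β ≤ T ^ β := Real.rpow_le_rpow hx.le (hnT n hnN) h0.le
  calc a * L ^ p * (((n : ℝ) * τ)⁻¹ +
      2 * C1 * L * (((n : ℝ) * τ) ^ (β - 1) * (1 + lam * τ) ^ n))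
      = a * L ^ p * ((n : ℝ) * τ)⁻¹ * (1 + 2 * C1 * L * (((n : ℝ) * τ) ^ β
          * (1 + lam * τ) ^ n)) := by
        rw [Real.rpow_sub_one hx.ne']; field_simp
    _ ≤ a * L ^ p * ((n : ℝ) * τ)⁻¹ * (L + 2 * C1 * L * (T ^ β * Real.exp (lam * T))) := by
        gcongr
    _ = (1 + 2 * C1 * T ^ β * Real.exp (lam * T)) * a * ((n : ℝ) * τ)⁻¹ * (L ^ p * L) := by ring
    _ ≤ _ := by gcongr
end

section
/- Let T > 0, b ≥ 0 and p ≥ 0. There exist constants c > 0 and τ₀ ∈ (0,1), depending only on b, p and T, such that the following holds. Let N ≥ 1 be an integer with τ := T/N ≤ τ₀, set t_j := jτ and ℓ_τ := |log τ|, let a ≥ 0, and let φ¹, …, φᴺ be nonnegative real numbers. If φⁿ ≤ a t_n^{−1} ℓ_τ^p + b τ Σ_{j=1}^{n} φʲ for all 1 ≤ n ≤ N, then φⁿ ≤ c a t_n^{−1} ℓ_τ^{p+1} for all 1 ≤ n ≤ N. -/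
open Real Finset

lemma aux_sum (N : ℕ) (x B : ℝ) (hx : 0 ≤ x) (hx2 : x ≤ 1/2) (hB : 0 ≤ B) (φ : ℕ → ℝ)
    (h0 : ∀ n, 1 ≤ n → n ≤ N → 0 ≤ φ n)
    (h : ∀ n, 1 ≤ n → n ≤ N → φ n ≤ B * (n:ℝ)⁻¹ + x * ∑ j ∈ Finset.Icc 1 n, φ j) :
    ∀ n, n ≤ N → ∑ j ∈ Finset.Icc 1 n, φ j ≤ (Real.exp (2*x))^n * (B * (harmonic n : ℝ)) := by
  have hK1 : 1 + 2*x ≤ Real.exp (2*x) := by linarith [Real.add_one_le_exp (2*x)]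
  have hK : 1 ≤ Real.exp (2*x) * (1 - x) := by nlinarith
  have hK0 : 1 ≤ Real.exp (2*x) := by linarith
  intro n
  induction n with
  | zero => intro _; simp
  | succ n ih =>
    intro hn
    have ih := ih (by omega)
    have hs := h (n+1) (by omega) hn
    have hS0 : 0 ≤ ∑ j ∈ Finset.Icc 1 (n+1), φ j := by
      apply Finset.sum_nonneg
      intro j hj
      rw [Finset.mem_Icc] at hj
      exact h0 j hj.1 (by omega)
    have hsum : ∑ j ∈ Finset.Icc 1 (n+1), φ j = ∑ j ∈ Finset.Icc 1 n, φ j + φ (n+1) :=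
      Finset.sum_Icc_succ_top (by omega) _
    have hH : ((harmonic (n+1) : ℚ) : ℝ) = (harmonic n : ℝ) + ((n+1 : ℕ) : ℝ)⁻¹ := by
      rw [harmonic_succ]; push_cast; rfl
    rw [hH]
    set S := ∑ j ∈ Finset.Icc 1 (n+1), φ j
    set S' := ∑ j ∈ Finset.Icc 1 n, φ j
    set K := Real.exp (2*x)
    have hr : 0 ≤ B * ((n+1 : ℕ) : ℝ)⁻¹ := by positivity
    set r := B * ((n+1 : ℕ) : ℝ)⁻¹ with hrdef
    have hKn : 1 ≤ K^n := one_le_pow₀ hK0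
    have e1 : (1 - x) * S ≤ S' + r := by linarith
    calc S ≤ (K * (1-x)) * S := by nlinarith
      _ = K * ((1-x) * S) := by ring
      _ ≤ K * (S' + r) := by gcongr
      _ ≤ K * (K^n * (B * (harmonic n : ℝ)) + K^n * r) := by
        gcongr
        nlinarith
      _ = _ := by rw [hrdef]; ring

/-- Basic discrete Gronwall inequality with logarithmic factors
(used in the proof of Lemma 3.8). -/
theorem discrete_gronwall_log_basic (T b p : ℝ) (hT : 0 < T) (hb : 0 ≤ b) (hp : 0 ≤ p) :
    ∃ c > (0:ℝ), ∃ τ₀ ∈ Set.Ioo (0:ℝ) 1,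
      ∀ N : ℕ, 1 ≤ N → T / N ≤ τ₀ →
      ∀ a : ℝ, 0 ≤ a → ∀ φ : ℕ → ℝ,
      (∀ n, 1 ≤ n → n ≤ N → 0 ≤ φ n) →
      (∀ n, 1 ≤ n → n ≤ N →
        φ n ≤ a * ((n : ℝ) * (T / N))⁻¹ * |Real.log (T / N)| ^ p
          + b * (T / N) * ∑ j ∈ Finset.Icc 1 n, φ j) →
      ∀ n, 1 ≤ n → n ≤ N →
        φ n ≤ c * a * ((n : ℝ) * (T / N))⁻¹ * |Real.log (T / N)| ^ (p + 1) := by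
  refine ⟨1 + b * Real.exp (2*b*T) * (2 + |Real.log T|) * T, by positivity,
    min (Real.exp (-1)) (1/(2*(b+1))), ⟨by positivity, ?_⟩, ?_⟩
  · exact min_lt_of_left_lt (by rw [Real.exp_lt_one_iff]; norm_num)
  intro N hN hτ a ha φ h0 h n hn1 hn
  have hNpos : (0:ℝ) < N := by exact_mod_cast hN
  have hnpos : (0:ℝ) < n := by exact_mod_cast hn1
  have hnN : (n:ℝ) ≤ N := by exact_mod_cast hn
  have hlogτ : Real.log (T / N) = Real.log T - Real.log N :=
    Real.log_div hT.ne' hNpos.ne'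
  have hNτ : (N:ℝ) * (T / N) = T := by field_simp
  have hτpos : 0 < T / N := by positivity
  have hlog : Real.log (T / N) ≤ -1 := by
    rw [Real.log_le_iff_le_exp hτpos]
    exact hτ.trans (min_le_left _ _)
  have hbτ : b * (T / N) ≤ 1/2 := by
    have h1 : T / N ≤ 1/(2*(b+1)) := hτ.trans (min_le_right _ _)
    rw [le_div_iff₀ (by positivity)] at h1
    nlinarith
  generalize T / (N:ℝ) = τ at *
  have habs : |Real.log τ| = - Real.log τ := abs_of_neg (by linarith)
  have hL1 : 1 ≤ |Real.log τ| := by linarith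
  have hlogN : Real.log N ≤ |Real.log τ| + |Real.log T| := by linarith [le_abs_self (Real.log T)]
  rw [Real.rpow_add_one (by linarith)]
  generalize |Real.log τ| = L at *
  have hLp : 0 ≤ L ^ p := by positivity
  generalize L ^ p = P at *
  have key := aux_sum N (b*τ) (a*P*τ⁻¹) (by positivity) hbτ (by positivity) φ h0
    (fun m h1 h2 => (h m h1 h2).trans_eq (by rw [mul_inv]; ring)) n hn
  have hexp : (Real.exp (2*(b*τ)))^n ≤ Real.exp (2*b*T) := by
    rw [← Real.exp_nat_mul]
    apply Real.exp_le_exp.mpr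
    calc (n:ℝ) * (2*(b*τ)) ≤ N * (2*(b*τ)) := by gcongr
      _ = 2 * b * (N * τ) := by ring
      _ = _ := by rw [hNτ]
  have hH : (harmonic n : ℝ) ≤ (2 + |Real.log T|) * L := by
    have h1 := harmonic_le_one_add_log n
    have h2 : Real.log n ≤ Real.log N := Real.log_le_log hnpos hnN
    nlinarith [abs_nonneg (Real.log T)]
  have hH0 : (0:ℝ) ≤ harmonic n := by
    exact_mod_cast (harmonic_pos (by omega)).le
  have hnτ : 1 ≤ T * ((n:ℝ)*τ)⁻¹ := by
    rw [← div_eq_mul_inv, one_le_div (by positivity), ← hNτ]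
    gcongr
  have hq : 0 ≤ ((n:ℝ)*τ)⁻¹ := by positivity
  have hn' := h n hn1 hn
  generalize ((n:ℝ)*τ)⁻¹ = q at *
  generalize Real.exp (2*b*T) = E at *
  have hE : 0 ≤ E := le_trans (by positivity) hexp
  have hL0 : 0 ≤ L := by linarith
  set M := 2 + |Real.log T|
  have hM : 0 ≤ M := by positivity
  calc φ n ≤ _ := hn'
    _ ≤ a * q * P + b * τ * (E * (a*P*τ⁻¹ * (M*L))) := by
      gcongr
      refine key.trans ?_
      gcongr
    _ = a * q * P * 1 + b * E * M * (a * P * L) * 1 := by field_simp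
    _ ≤ a * q * P * L + b * E * M * (a * P * L) * (T * q) := by gcongr
    _ = _ := by ring
end

section
/- For every β ∈ (0,1] there exists a constant c > 0, depending only on β, such that for every integer n ≥ 1, Σ_{j=1}^{n} (n−j+1)^{β−1} j^{−1} ≤ c n^{β−1} (1 + log n); equivalently, for every τ > 0, with t_j := jτ, one has τ Σ_{j=1}^{n} t_{n−j+1}^{β−1} t_j^{−1} ≤ c t_n^{β−1} (1 + log n). -/
open Real Finset

lemma aux_step (β : ℝ) (h0 : 0 < β) (h1 : β ≤ 1) (k : ℕ) :
    (k : ℝ) ^ β + β * ((k + 1 : ℕ) : ℝ) ^ (β - 1) ≤ ((k + 1 : ℕ) : ℝ) ^ β := by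
  have hk : (0 : ℝ) < ((k + 1 : ℕ) : ℝ) := by positivity
  set K : ℝ := ((k + 1 : ℕ) : ℝ) with hK
  have hkK : (k : ℝ) = K * (1 + (-(1 / K))) := by
    field_simp
    rw [hK]; push_cast; ring
  have hK1 : (1 : ℝ) ≤ K := by rw [hK]; push_cast; linarith [Nat.cast_nonneg (α := ℝ) k]
  have h1K : 1 / K ≤ 1 := by rw [div_le_one hk]; exact hK1
  have hb := _root_.rpow_one_add_le_one_add_mul_self (s := -(1 / K)) (by linarith) h0.le h1
  rw [hkK, Real.mul_rpow hk.le (by linarith), Real.rpow_sub_one hk.ne']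
  have hp : 0 < K ^ β := Real.rpow_pos_of_pos hk _
  have := mul_le_mul_of_nonneg_left hb hp.le
  have e : K ^ β * (1 + β * -(1 / K)) = K ^ β - β * (K ^ β / K) := by ring
  linarith

lemma aux_sum_s10 (β : ℝ) (h0 : 0 < β) (h1 : β ≤ 1) (n : ℕ) :
    β * ∑ j ∈ Finset.Icc 1 n, (j : ℝ) ^ (β - 1) ≤ (n : ℝ) ^ β := by
  induction n with
  | zero => simp [Real.zero_rpow h0.ne']
  | succ k ih =>
    rw [Finset.sum_Icc_succ_top (by omega), mul_add]
    linarith [aux_step β h0 h1 k]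

lemma aux_main (β : ℝ) (h0 : 0 < β) (h1 : β ≤ 1) (n : ℕ) (hn : 1 ≤ n) :
    ∑ j ∈ Finset.Icc 1 n, ((n - j + 1 : ℕ) : ℝ) ^ (β - 1) * ((j : ℝ))⁻¹
        ≤ (1 + 1 / β) * (n : ℝ) ^ (β - 1) * (1 + Real.log n) := by
  have hn0 : (0 : ℝ) < n := by exact_mod_cast hn
  have hrefl : ∑ j ∈ Finset.Icc 1 n, ((n - j + 1 : ℕ) : ℝ) ^ (β - 1)
      = ∑ j ∈ Finset.Icc 1 n, (j : ℝ) ^ (β - 1) := by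
    refine Finset.sum_nbij' (fun j => n - j + 1) (fun j => n - j + 1) ?_ ?_ ?_ ?_ ?_
    · intro a ha; simp only [Finset.mem_Icc] at *; omega
    · intro a ha; simp only [Finset.mem_Icc] at *; omega
    · intro a ha; simp only [Finset.mem_Icc] at *; omega
    · intro a ha; simp only [Finset.mem_Icc] at *; omega
    · intro a ha; rfl
  have hs := aux_sum_s10 β h0 h1 n
  have hH : ∑ j ∈ Finset.Icc 1 n, ((j : ℝ))⁻¹ ≤ 1 + Real.log n := by
    have := harmonic_le_one_add_log n
    rw [harmonic_eq_sum_Icc] at this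
    push_cast at this
    exact this
  have hlog : 0 ≤ Real.log n := Real.log_natCast_nonneg n
  have hterm : ∀ j ∈ Finset.Icc 1 n, ((n - j + 1 : ℕ) : ℝ) ^ (β - 1) * ((j : ℝ))⁻¹
      ≤ (1 / (n : ℝ)) * ((n : ℝ) ^ β * ((j : ℝ))⁻¹ + ((n - j + 1 : ℕ) : ℝ) ^ (β - 1)) := by
    intro j hj
    rw [Finset.mem_Icc] at hj
    have hj0 : (0 : ℝ) < j := by exact_mod_cast hj.1
    have hk0 : (0 : ℝ) < ((n - j + 1 : ℕ) : ℝ) := by positivity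
    have hsum : ((n - j + 1 : ℕ) : ℝ) + j = n + 1 := by
      have : (n - j + 1) + j = n + 1 := by omega
      exact_mod_cast this
    have hle : ((n - j + 1 : ℕ) : ℝ) ≤ n := by
      have : (n - j + 1) ≤ n := by omega
      exact_mod_cast this
    set K : ℝ := ((n - j + 1 : ℕ) : ℝ)
    have hp : K ^ β ≤ (n : ℝ) ^ β := Real.rpow_le_rpow hk0.le hle h0.le
    have hq : 0 < K ^ (β - 1) := Real.rpow_pos_of_pos hk0 _
    have hpq : K ^ β = K ^ (β - 1) * K := by
      rw [Real.rpow_sub_one hk0.ne']; field_simp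
    rw [hpq] at hp
    generalize K ^ (β - 1) = q at *
    generalize (n : ℝ) ^ β = p at *
    have e : (1 / (n : ℝ)) * (p * ((j : ℝ))⁻¹ + q) = (p + q * j) / (n * j) := by
      field_simp
    rw [e, ← div_eq_mul_inv, div_le_div_iff₀ hj0 (by positivity)]
    have : q * n ≤ p + q * j := by
      have : q * K + q * j = q * n + q := by rw [← mul_add, hsum]; ring
      linarith
    nlinarith
  refine (Finset.sum_le_sum hterm).trans ?_
  rw [← Finset.mul_sum, Finset.sum_add_distrib, ← Finset.mul_sum, hrefl,
    Real.rpow_sub_one hn0.ne']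
  have hP : 0 < (n : ℝ) ^ β := Real.rpow_pos_of_pos hn0 _
  have hs' : ∑ j ∈ Finset.Icc 1 n, (j : ℝ) ^ (β - 1) ≤ (n : ℝ) ^ β * (1 / β) := by
    rw [mul_one_div, le_div_iff₀ h0]; linarith
  have hb : 0 < 1 / β := by positivity
  have h2 := mul_le_mul_of_nonneg_left hH hP.le
  have h3 : 0 ≤ (n : ℝ) ^ β * (1 / β) * Real.log n := by positivity
  have e : (1 + 1 / β) * ((n : ℝ) ^ β / n) * (1 + Real.log n)
      = (1 / (n : ℝ)) * ((1 + 1 / β) * (n : ℝ) ^ β * (1 + Real.log n)) := by ring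
  rw [e]
  apply mul_le_mul_of_nonneg_left _ (by positivity)
  linarith

/-- Discrete weakly singular convolution estimate with a logarithmic factor
(used in the proof of Lemma 3.8). -/
theorem discrete_convolution_log (β : ℝ) (hβ : β ∈ Set.Ioc (0:ℝ) 1) :
    ∃ c > (0:ℝ), ∀ n : ℕ, 1 ≤ n →
      (∑ j ∈ Finset.Icc 1 n, ((n - j + 1 : ℕ) : ℝ) ^ (β - 1) * ((j : ℝ))⁻¹
        ≤ c * (n : ℝ) ^ (β - 1) * (1 + Real.log n)) ∧
      ∀ τ : ℝ, 0 < τ →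
        τ * ∑ j ∈ Finset.Icc 1 n, (((n - j + 1 : ℕ) : ℝ) * τ) ^ (β - 1) * ((j : ℝ) * τ)⁻¹
          ≤ c * ((n : ℝ) * τ) ^ (β - 1) * (1 + Real.log n) := by
  obtain ⟨h0, h1⟩ := hβ
  refine ⟨1 + 1 / β, by positivity, fun n hn => ⟨aux_main β h0 h1 n hn, fun τ hτ => ?_⟩⟩
  have h := mul_le_mul_of_nonneg_left (aux_main β h0 h1 n hn)
    (Real.rpow_pos_of_pos hτ (β - 1)).le
  have e : τ * ∑ j ∈ Finset.Icc 1 n, (((n - j + 1 : ℕ) : ℝ) * τ) ^ (β - 1) * ((j : ℝ) * τ)⁻¹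
      = τ ^ (β - 1) * ∑ j ∈ Finset.Icc 1 n, ((n - j + 1 : ℕ) : ℝ) ^ (β - 1) * ((j : ℝ))⁻¹ := by
    rw [Finset.mul_sum, Finset.mul_sum]
    refine Finset.sum_congr rfl fun j _ => ?_
    rw [Real.mul_rpow (Nat.cast_nonneg _) hτ.le, mul_inv]
    field_simp
  rw [e, Real.mul_rpow (Nat.cast_nonneg _) hτ.le]
  refine h.trans (le_of_eq ?_)
  ring
end

section
/- For every α ∈ (0,1), every ε ∈ (0, α) and every T > 0, the double integral ∫₀ᵀ ∫₀ᵀ |t^{α−1} − s^{α−1}| / |t−s|^{1+α−ε} ds dt is finite; that is, the function t ↦ t^{α−1} has finite Sobolev–Slobodeckij seminorm in W^{α−ε,1}(0,T). -/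
open Real MeasureTheory Set ENNReal

lemma slob_pt1 (α ε s t : ℝ) (h0 : 0 < ε) (h1 : ε < α) (h2 : α < 1) (hs : 0 < s) (hst : s < t) :
    (s ^ (α - 1) - t ^ (α - 1)) / (t - s) ^ (1 + α - ε)
      ≤ s ^ (ε / 2 - 1) * (t - s) ^ (ε / 2 - 1) := by
  have ht : 0 < t := hs.trans hst
  have hd : 0 < t - s := sub_pos.2 hst
  rw [div_le_iff₀ (by positivity)]
  have e1 : s ^ (ε / 2 - 1) * (t - s) ^ (ε / 2 - 1) * (t - s) ^ (1 + α - ε)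
      = s ^ (α - 1) * ((t - s) / s) ^ (α - ε / 2) := by
    rw [mul_assoc, ← Real.rpow_add hd, Real.div_rpow hd.le hs.le, ← mul_div_assoc, mul_div_right_comm,
      ← Real.rpow_sub hs]
    ring_nf
  rw [e1]
  have hx0 : 0 < s / t := by positivity
  have hx1 : s / t ≤ 1 := (div_le_one ht).2 hst.le
  have e2 : t ^ (α - 1) = s ^ (α - 1) * (s / t) ^ (1 - α) := by
    rw [Real.div_rpow hs.le ht.le, ← mul_div_assoc, ← Real.rpow_add hs]
    rw [show α - 1 + (1 - α) = 0 by ring, Real.rpow_zero, one_div, ← Real.rpow_neg ht.le]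
    ring_nf
  rw [e2, ← mul_one_sub]
  have h3 : s / t ≤ (s / t) ^ (1 - α) := by
    simpa using Real.rpow_le_rpow_of_exponent_ge hx0 hx1 (show 1 - α ≤ 1 by linarith)
  have h4 : 1 - s / t = (t - s) / t := by field_simp
  have hy0 : 0 < (t - s) / t := by positivity
  have h5 : (t - s) / t ≤ ((t - s) / t) ^ (α - ε / 2) := by
    simpa using Real.rpow_le_rpow_of_exponent_ge hy0 (by linarith)
      (show α - ε / 2 ≤ 1 by linarith)
  have h6 : ((t - s) / t) ^ (α - ε / 2) ≤ ((t - s) / s) ^ (α - ε / 2) := by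
    apply Real.rpow_le_rpow hy0.le _ (by linarith)
    gcongr
  gcongr
  linarith

lemma slob_pt (α ε s t : ℝ) (h0 : 0 < ε) (h1 : ε < α) (h2 : α < 1) (hs : 0 < s) (ht : 0 < t) :
    |t ^ (α - 1) - s ^ (α - 1)| / |t - s| ^ (1 + α - ε)
      ≤ s ^ (ε / 2 - 1) * |t - s| ^ (ε / 2 - 1) + t ^ (ε / 2 - 1) * |t - s| ^ (ε / 2 - 1) := by
  have p1 : 0 ≤ s ^ (ε / 2 - 1) * |t - s| ^ (ε / 2 - 1) := by positivity
  have p2 : 0 ≤ t ^ (ε / 2 - 1) * |t - s| ^ (ε / 2 - 1) := by positivity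
  rcases lt_trichotomy s t with h | h | h
  · have := slob_pt1 α ε s t h0 h1 h2 hs h
    have hm : t ^ (α - 1) ≤ s ^ (α - 1) :=
      Real.rpow_le_rpow_of_nonpos hs h.le (by linarith)
    rw [abs_of_pos (sub_pos.2 h)] at *
    rw [abs_of_nonpos (by linarith), neg_sub]
    linarith
  · subst h
    simp only [sub_self, abs_zero, zero_div] at *
    linarith
  · have := slob_pt1 α ε t s h0 h1 h2 ht h
    have hm : s ^ (α - 1) ≤ t ^ (α - 1) :=
      Real.rpow_le_rpow_of_nonpos ht h.le (by linarith)
    rw [abs_sub_comm t s, abs_of_pos (sub_pos.2 h)] at *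
    rw [abs_of_nonneg (by linarith)]
    linarith

lemma slob_int (b T : ℝ) (hb : -1 < b) (hT : 0 < T) :
    IntegrableOn (fun u : ℝ => |u| ^ b) (Ioo (-T) T) := by
  have h1 : IntegrableOn (fun u : ℝ => u ^ b) (Ioo (-T) T) :=
    ((intervalIntegrable_iff_integrableOn_Ioo_of_le (by linarith)).1
      (intervalIntegral.intervalIntegrable_rpow' hb))
  have h2 : IntegrableOn (fun u : ℝ => (-u) ^ b) (Ioo (-T) T) := by
    refine ((intervalIntegrable_iff_integrableOn_Ioo_of_le (by linarith)).1 ?_)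
    have := (intervalIntegral.intervalIntegrable_rpow' (a := T) (b := -T) hb).comp_sub_left 0
    simpa using this
  refine (h1.norm.add h2.norm).mono' (Measurable.aestronglyMeasurable (by fun_prop)) (Filter.Eventually.of_forall fun u => ?_)
  simp only [Pi.add_apply, Real.norm_eq_abs]
  have hp : 0 ≤ |u| ^ b := by positivity
  rw [abs_of_nonneg hp]
  rcases le_total 0 u with h | h
  · rw [abs_of_nonneg h]
    linarith [le_abs_self (u ^ b), abs_nonneg ((-u) ^ b)]
  · rw [abs_of_nonpos h]
    linarith [le_abs_self ((-u) ^ b), abs_nonneg (u ^ b)]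

lemma slob_inner (b T t : ℝ) (ht : t ∈ Ioo 0 T) :
    ∫⁻ s in Ioo (0:ℝ) T, ENNReal.ofReal (|t - s| ^ b)
      ≤ ∫⁻ u in Ioo (-T) T, ENNReal.ofReal (|u| ^ b) := by
  rw [← lintegral_indicator measurableSet_Ioo, ← lintegral_indicator measurableSet_Ioo,
    ← lintegral_sub_left_eq_self ((Ioo (-T) T).indicator fun u => ENNReal.ofReal (|u| ^ b)) t]
  refine lintegral_mono fun s => ?_
  by_cases hs : s ∈ Ioo 0 T
  · have : t - s ∈ Ioo (-T) T := ⟨by linarith [ht.1, hs.2], by linarith [ht.2, hs.1]⟩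
    simp only [indicator_of_mem hs, indicator_of_mem this]
    exact le_rfl
  · simp [indicator_of_notMem hs]

/-- The function `t ↦ t^{α−1}` has finite Sobolev–Slobodeckij seminorm in `W^{α−ε,1}(0,T)`
(established in the proof of Theorem 2.9). -/
theorem slobodeckij_seminorm_finite (α ε T : ℝ) (hα : α ∈ Set.Ioo (0:ℝ) 1)
    (hε : ε ∈ Set.Ioo (0:ℝ) α) (hT : 0 < T) :
    (∫⁻ t in Set.Ioo (0:ℝ) T, ∫⁻ s in Set.Ioo (0:ℝ) T,
        ENNReal.ofReal (|t ^ (α - 1) - s ^ (α - 1)| / |t - s| ^ (1 + α - ε))) < ⊤ := by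
  obtain ⟨b, hbdef⟩ : ∃ b, b = ε / 2 - 1 := ⟨_, rfl⟩
  have hb : -1 < b := by linarith [hε.1]
  set K := ∫⁻ u in Ioo (-T) T, ENNReal.ofReal (|u| ^ b) with hK
  have hKfin : K < ⊤ := (slob_int b T hb hT).lintegral_lt_top
  have hJfin : ∫⁻ t in Ioo 0 T, ENNReal.ofReal (t ^ b) < ⊤ :=
    Integrable.lintegral_lt_top ((intervalIntegrable_iff_integrableOn_Ioo_of_le hT.le).1
      (intervalIntegral.intervalIntegrable_rpow' hb))
  have hA : ∫⁻ t in Ioo 0 T, ∫⁻ s in Ioo 0 T,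
      ENNReal.ofReal (t ^ b) * ENNReal.ofReal (|t - s| ^ b)
      ≤ (∫⁻ t in Ioo 0 T, ENNReal.ofReal (t ^ b)) * K := by
    rw [← lintegral_mul_const _ (by fun_prop)]
    refine setLIntegral_mono' measurableSet_Ioo fun t ht => ?_
    rw [lintegral_const_mul _ (by fun_prop)]
    gcongr
    exact slob_inner b T t ht
  have hB : ∫⁻ t in Ioo 0 T, ∫⁻ s in Ioo 0 T,
      ENNReal.ofReal (s ^ b) * ENNReal.ofReal (|t - s| ^ b)
      ≤ (∫⁻ t in Ioo 0 T, ENNReal.ofReal (t ^ b)) * K := by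
    rw [lintegral_lintegral_swap (by fun_prop)]
    simpa only [abs_sub_comm] using hA
  calc _ ≤ ∫⁻ t in Ioo 0 T, ((∫⁻ s in Ioo 0 T,
          ENNReal.ofReal (s ^ b) * ENNReal.ofReal (|t - s| ^ b)) +
          ∫⁻ s in Ioo 0 T, ENNReal.ofReal (t ^ b) * ENNReal.ofReal (|t - s| ^ b)) := by
        refine setLIntegral_mono' measurableSet_Ioo fun t ht => ?_
        rw [← lintegral_add_left (by fun_prop)]
        refine setLIntegral_mono' measurableSet_Ioo fun s hs => ?_
        have hs0 : 0 < s := hs.1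
        have ht0 : 0 < t := ht.1
        rw [← ENNReal.ofReal_mul (by positivity), ← ENNReal.ofReal_mul (by positivity),
          ← ENNReal.ofReal_add (by positivity) (by positivity), hbdef]
        exact ENNReal.ofReal_le_ofReal (slob_pt α ε s t hε.1 hε.2 hα.2 hs0 ht0)
    _ = _ := lintegral_add_left (Measurable.lintegral_prod_right' (f := fun p : ℝ × ℝ =>
          ENNReal.ofReal (p.2 ^ b) * ENNReal.ofReal (|p.1 - p.2| ^ b)) (by fun_prop)) _
    _ < ⊤ := ENNReal.add_lt_top.2 ⟨hB.trans_lt (ENNReal.mul_lt_top hJfin hKfin),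
          hA.trans_lt (ENNReal.mul_lt_top hJfin hKfin)⟩
end

section
/- Let E be a real normed space, α ∈ (0,1), ε ∈ (0, α), T > 0 and M ≥ 0. Suppose w : (0,T] → E satisfies ‖w(t) − w(s)‖_E ≤ M |t^{α−1} − s^{α−1}| for all s, t ∈ (0,T]. Then there exists a constant c > 0, depending only on α, ε and T, such that ∫₀ᵀ ∫₀ᵀ ‖w(t) − w(s)‖_E / |t−s|^{1+α−ε} ds dt ≤ c M; in particular this Sobolev–Slobodeckij seminorm of w is finite. -/
open Real MeasureTheory Set ENNReal

/-- Pointwise interpolation bound. -/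
lemma kernel_bound (α ε s t : ℝ) (hα : α ∈ Set.Ioo (0:ℝ) 1) (hε : ε ∈ Set.Ioo (0:ℝ) α)
    (hs : 0 < s) (hst : s < t) :
    |t ^ (α - 1) - s ^ (α - 1)| / |t - s| ^ (1 + α - ε)
      ≤ s ^ (ε / 2 - 1) * (t - s) ^ (ε / 2 - 1) := by
  obtain ⟨ha0, ha1⟩ := hα
  obtain ⟨he0, he1⟩ := hε
  have ht : 0 < t := hs.trans hst
  have hd : 0 < t - s := sub_pos.2 hst
  have hle : t ^ (α - 1) ≤ s ^ (α - 1) :=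
    Real.rpow_le_rpow_of_nonpos hs hst.le (by linarith)
  rw [abs_of_pos hd, abs_of_nonpos (by linarith), div_le_iff₀ (Real.rpow_pos_of_pos hd _),
    mul_assoc, ← Real.rpow_add hd]
  have e1 : ε / 2 - 1 + (1 + α - ε) = α - ε / 2 := by ring
  rw [e1]
  have h1 : s / t ≤ (s / t) ^ (1 - α) := by
    have := Real.rpow_le_rpow_of_exponent_ge (x := s / t) (y := 1) (z := 1 - α) (by positivity)
      ((div_le_one ht).2 hst.le) (by linarith)
    simpa using this
  have h2 : t ^ (α - 1) = s ^ (α - 1) * (s / t) ^ (1 - α) := by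
    rw [Real.div_rpow hs.le ht.le, show α - 1 = -(1 - α) by ring, Real.rpow_neg hs.le,
      Real.rpow_neg ht.le]
    have := (Real.rpow_pos_of_pos hs (1 - α)).ne'
    field_simp
  have hx0 : 0 < (t - s) / t := by positivity
  have hx1 : (t - s) / t ≤ 1 := (div_le_one ht).2 (by linarith)
  have h3 : (t - s) / t ≤ ((t - s) / s) ^ (α - ε / 2) := by
    calc (t - s) / t = ((t - s) / t) ^ (1 : ℝ) := by simp
      _ ≤ ((t - s) / t) ^ (α - ε / 2) :=
        Real.rpow_le_rpow_of_exponent_ge hx0 hx1 (by linarith)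
      _ ≤ ((t - s) / s) ^ (α - ε / 2) :=
        Real.rpow_le_rpow hx0.le (div_le_div_of_nonneg_left hd.le hs hst.le) (by linarith)
  have hsp := Real.rpow_pos_of_pos hs (α - 1)
  have h4 : 1 - s / t = (t - s) / t := by field_simp
  calc -(t ^ (α - 1) - s ^ (α - 1)) = s ^ (α - 1) * (1 - (s / t) ^ (1 - α)) := by
        rw [h2]; ring
    _ ≤ s ^ (α - 1) * ((t - s) / s) ^ (α - ε / 2) := by
        apply mul_le_mul_of_nonneg_left _ hsp.le
        linarith
    _ = s ^ (ε / 2 - 1) * (t - s) ^ (α - ε / 2) := by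
        rw [Real.div_rpow hd.le hs.le, show ε / 2 - 1 = (α - 1) - (α - ε / 2) by ring,
          Real.rpow_sub hs (α - 1) (α - ε / 2)]
        ring

lemma conv_total (h : ℝ → ℝ≥0∞) (hm : Measurable h) :
    ∫⁻ t, ∫⁻ s, (h s * h (t - s) + h t * h (s - t)) = 2 * ((∫⁻ x, h x) * ∫⁻ x, h x) := by
  have m1 : Measurable fun p : ℝ × ℝ => h p.2 * h (p.1 - p.2) := by fun_prop
  have i2 : ∀ t, ∫⁻ s, h t * h (s - t) = h t * ∫⁻ x, h x := fun t => by
    rw [lintegral_const_mul _ (by fun_prop), lintegral_sub_right_eq_self]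
  have i1 : ∫⁻ t, ∫⁻ s, h s * h (t - s) = (∫⁻ x, h x) * ∫⁻ x, h x := by
    rw [lintegral_lintegral_swap (f := fun t s => h s * h (t - s)) m1.aemeasurable]
    simp_rw [i2]
    rw [lintegral_mul_const _ hm]
  have : ∀ t, ∫⁻ s, (h s * h (t - s) + h t * h (s - t))
      = (∫⁻ s, h s * h (t - s)) + h t * ∫⁻ x, h x := fun t => by
    rw [lintegral_add_left (by fun_prop), i2]
  simp_rw [this]
  rw [lintegral_add_right _ (by fun_prop), i1, lintegral_mul_const _ hm, two_mul]

/-- Vector-valued Sobolev–Slobodeckij seminorm bound for functions whose increments are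
controlled by `|t^{α−1} − s^{α−1}|` (established in the proof of Theorem 2.9). -/
theorem slobodeckij_seminorm_bound (E : Type*) [NormedAddCommGroup E] [NormedSpace ℝ E]
    (α ε T : ℝ) (hα : α ∈ Set.Ioo (0:ℝ) 1) (hε : ε ∈ Set.Ioo (0:ℝ) α) (hT : 0 < T) :
    ∃ c > (0:ℝ), ∀ M : ℝ, 0 ≤ M → ∀ w : ℝ → E,
      (∀ s ∈ Set.Ioc (0:ℝ) T, ∀ t ∈ Set.Ioc (0:ℝ) T,
        ‖w t - w s‖ ≤ M * |t ^ (α - 1) - s ^ (α - 1)|) →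
      (∫⁻ t in Set.Ioo (0:ℝ) T, ∫⁻ s in Set.Ioo (0:ℝ) T,
          ENNReal.ofReal (‖w t - w s‖ / |t - s| ^ (1 + α - ε)))
        ≤ ENNReal.ofReal (c * M) := by
  set h : ℝ → ℝ≥0∞ := (Set.Ioo (0:ℝ) T).indicator fun x => ENNReal.ofReal (x ^ (ε / 2 - 1))
    with hh
  have hm : Measurable h := Measurable.indicator (by fun_prop) measurableSet_Ioo
  have hB : ∫⁻ x, h x ≠ ∞ := by
    rw [hh, lintegral_indicator measurableSet_Ioo]
    have hi : IntegrableOn (fun x : ℝ => x ^ (ε / 2 - 1)) (Set.Ioo 0 T) :=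
      (intervalIntegral.integrableOn_Ioo_rpow_iff hT).2 (by linarith [hε.1])
    exact hi.lintegral_lt_top.ne
  have hval : ∀ x ∈ Set.Ioo (0:ℝ) T, h x = ENNReal.ofReal (x ^ (ε / 2 - 1)) := fun x hx => by
    rw [hh, Set.indicator_of_mem hx]
  set B := ∫⁻ x, h x
  have hfin : 2 * (B * B) ≠ ∞ := by finiteness
  refine ⟨(2 * (B * B)).toReal + 1, by positivity, fun M hM w hw => ?_⟩
  -- the one-sided pointwise bound
  have key : ∀ s ∈ Set.Ioo (0:ℝ) T, ∀ t ∈ Set.Ioo (0:ℝ) T, s < t →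
      ENNReal.ofReal (‖w t - w s‖ / |t - s| ^ (1 + α - ε))
        ≤ ENNReal.ofReal M * (h s * h (t - s)) := by
    intro s hs t ht hst
    have hd : 0 < t - s := sub_pos.2 hst
    rw [hval s hs, hval (t - s) ⟨hd, by linarith [hs.1, ht.2]⟩,
      ← ENNReal.ofReal_mul (Real.rpow_nonneg hs.1.le _), ← ENNReal.ofReal_mul hM]
    apply ENNReal.ofReal_le_ofReal
    calc ‖w t - w s‖ / |t - s| ^ (1 + α - ε)
        ≤ (M * |t ^ (α - 1) - s ^ (α - 1)|) / |t - s| ^ (1 + α - ε) := by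
          gcongr
          exact hw s ⟨hs.1, hs.2.le⟩ t ⟨ht.1, ht.2.le⟩
      _ = M * (|t ^ (α - 1) - s ^ (α - 1)| / |t - s| ^ (1 + α - ε)) := by ring
      _ ≤ _ := mul_le_mul_of_nonneg_left (kernel_bound α ε s t hα hε hs.1 hst) hM
  have key2 : ∀ t ∈ Set.Ioo (0:ℝ) T, ∀ s ∈ Set.Ioo (0:ℝ) T,
      ENNReal.ofReal (‖w t - w s‖ / |t - s| ^ (1 + α - ε))
        ≤ ENNReal.ofReal M * (h s * h (t - s) + h t * h (s - t)) := by
    intro t ht s hs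
    rcases lt_trichotomy s t with hst | rfl | hst
    · exact (key s hs t ht hst).trans (by gcongr; exact le_self_add)
    · simp
    · rw [norm_sub_rev, abs_sub_comm]
      exact (key t ht s hs hst).trans (by gcongr; exact le_add_self)
  calc (∫⁻ t in Set.Ioo (0:ℝ) T, ∫⁻ s in Set.Ioo (0:ℝ) T,
          ENNReal.ofReal (‖w t - w s‖ / |t - s| ^ (1 + α - ε)))
      ≤ ∫⁻ t in Set.Ioo (0:ℝ) T, ∫⁻ s in Set.Ioo (0:ℝ) T,
          ENNReal.ofReal M * (h s * h (t - s) + h t * h (s - t)) :=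
        setLIntegral_mono' measurableSet_Ioo fun t ht =>
          setLIntegral_mono' measurableSet_Ioo fun s hs => key2 t ht s hs
    _ ≤ ∫⁻ t, ∫⁻ s, ENNReal.ofReal M * (h s * h (t - s) + h t * h (s - t)) :=
        (setLIntegral_le_lintegral _ _).trans
          (lintegral_mono fun t => setLIntegral_le_lintegral _ _)
    _ = ENNReal.ofReal M * (2 * (B * B)) := by
        simp_rw [lintegral_const_mul' _ _ ENNReal.ofReal_ne_top]
        rw [conv_total h hm]
    _ = ENNReal.ofReal ((2 * (B * B)).toReal * M) := by
        rw [ENNReal.ofReal_mul ENNReal.toReal_nonneg, ENNReal.ofReal_toReal hfin, mul_comm]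
    _ ≤ _ := ENNReal.ofReal_le_ofReal (by nlinarith)
end

section
/- For every a ∈ (0,1) and every b ∈ (0,1) there exists a constant c > 0, depending only on a and b, such that for all t > 0 and all τ ∈ (0, t), ∫_τ^t ξ^{a−2} (t + τ − ξ)^{b−1} dξ ≤ c ( τ^{a−1} t^{b−1} + t^{a+b−2} ). -/
open Real MeasureTheory Set ENNReal

/-- Weakly singular convolution estimate used in the proof of Lemma 3.6. -/
theorem weakly_singular_convolution_estimate (a b : ℝ) (ha : a ∈ Set.Ioo (0:ℝ) 1)
    (hb : b ∈ Set.Ioo (0:ℝ) 1) :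
    ∃ c > (0:ℝ), ∀ t : ℝ, 0 < t → ∀ τ : ℝ, τ ∈ Set.Ioo (0:ℝ) t →
      (∫⁻ ξ in Set.Ioo τ t, ENNReal.ofReal (ξ ^ (a - 2) * (t + τ - ξ) ^ (b - 1)))
        ≤ ENNReal.ofReal (c * (τ ^ (a - 1) * t ^ (b - 1) + t ^ (a + b - 2))) := by
  obtain ⟨ha0, ha1⟩ := ha
  obtain ⟨hb0, hb1⟩ := hb
  have h1a : 0 < 1 - a := by linarith
  have hA : 0 < (1/2:ℝ) ^ (b-1) / (1-a) := by positivity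
  have hB : 0 < (1/2:ℝ) ^ (a-2) / b := by positivity
  refine ⟨(1/2:ℝ) ^ (b-1) / (1-a) + (1/2:ℝ) ^ (a-2) / b, by positivity, ?_⟩
  rintro t ht τ ⟨hτ, hτt⟩
  set K : ℝ := (t * (1/2)) ^ (b-1) with hK
  set L : ℝ := (t * (1/2)) ^ (a-2) with hL
  have hK0 : 0 < K := by positivity
  have hL0 : 0 < L := by positivity
  have h0 : (0:ℝ) ∉ uIcc τ t := by
    rw [uIcc_of_le hτt.le]; intro h; linarith [h.1]
  have i1 : IntervalIntegrable (fun ξ : ℝ => ξ ^ (a-2)) volume τ t :=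
    intervalIntegral.intervalIntegrable_rpow (Or.inr h0)
  have i2' : IntervalIntegrable (fun ξ : ℝ => ξ ^ (b-1)) volume τ t :=
    intervalIntegral.intervalIntegrable_rpow (Or.inr h0)
  have i2 : IntervalIntegrable (fun ξ : ℝ => (t + τ - ξ) ^ (b-1)) volume τ t := by
    have := (i2'.comp_sub_left (t + τ)).symm
    simpa using this
  have hi := (i1.const_mul K).add (i2.const_mul L)
  have hion : IntegrableOn (fun ξ : ℝ => K * ξ ^ (a-2) + L * (t + τ - ξ) ^ (b-1)) (Ioo τ t) :=
    ((intervalIntegrable_iff_integrableOn_Ioo_of_le hτt.le).1 hi)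
  have e1 : ∫ ξ in τ..t, ξ ^ (a-2) = (t ^ (a-1) - τ ^ (a-1)) / (a-1) := by
    rw [integral_rpow (Or.inr ⟨by linarith, h0⟩)]
    rw [show a - 2 + 1 = a - 1 by ring]
  have e2 : ∫ ξ in τ..t, (t + τ - ξ) ^ (b-1) = (t ^ b - τ ^ b) / b := by
    rw [intervalIntegral.integral_comp_sub_left (fun x : ℝ => x ^ (b-1)) (t + τ)]
    rw [show t + τ - t = τ by ring, show t + τ - τ = t by ring,
      integral_rpow (Or.inl (by linarith)), show b - 1 + 1 = b by ring]
  calc (∫⁻ ξ in Set.Ioo τ t, ENNReal.ofReal (ξ ^ (a - 2) * (t + τ - ξ) ^ (b - 1)))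
      ≤ ∫⁻ ξ in Set.Ioo τ t, ENNReal.ofReal (K * ξ ^ (a-2) + L * (t + τ - ξ) ^ (b-1)) := by
        refine setLIntegral_mono' measurableSet_Ioo fun ξ hξ => ENNReal.ofReal_le_ofReal ?_
        have hx : 0 < ξ := hτ.trans hξ.1
        have hs : 0 < t + τ - ξ := by linarith [hξ.2]
        have p1 : 0 < ξ ^ (a-2) := by positivity
        have p2 : 0 < (t + τ - ξ) ^ (b-1) := by positivity
        rcases le_total ξ (t * (1/2)) with h | h
        · have : (t + τ - ξ) ^ (b-1) ≤ K :=
            Real.rpow_le_rpow_of_nonpos (by positivity) (by linarith) (by linarith)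
          nlinarith [mul_pos hL0 p2]
        · have : ξ ^ (a-2) ≤ L :=
            Real.rpow_le_rpow_of_nonpos (by positivity) h (by linarith)
          nlinarith [mul_pos hK0 p1]
    _ = ENNReal.ofReal (∫ ξ in Set.Ioo τ t, (K * ξ ^ (a-2) + L * (t + τ - ξ) ^ (b-1))) := by
        rw [ofReal_integral_eq_lintegral_ofReal hion]
        refine (ae_restrict_iff' measurableSet_Ioo).2 (Filter.Eventually.of_forall fun ξ hξ => ?_)
        have hx : 0 < ξ := hτ.trans hξ.1
        have hs : 0 < t + τ - ξ := by linarith [hξ.2]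
        simp only [Pi.zero_apply]
        positivity
    _ ≤ _ := by
        apply ENNReal.ofReal_le_ofReal
        rw [← integral_Ioc_eq_integral_Ioo, ← intervalIntegral.integral_of_le hτt.le,
          intervalIntegral.integral_add (i1.const_mul K) (i2.const_mul L),
          intervalIntegral.integral_const_mul, intervalIntegral.integral_const_mul, e1, e2]
        have q1 : (t ^ (a-1) - τ ^ (a-1)) / (a-1) ≤ τ ^ (a-1) / (1-a) := by
          rw [← neg_div_neg_eq, neg_sub, neg_sub]
          have : 0 < t ^ (a-1) := by positivity
          gcongr
          linarith
        have q2 : (t ^ b - τ ^ b) / b ≤ t ^ b / b := by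
          have : 0 < τ ^ b := by positivity
          gcongr
          linarith
        have k1 : K = t ^ (b-1) * (1/2) ^ (b-1) := Real.mul_rpow ht.le (by norm_num)
        have l1 : L = t ^ (a-2) * (1/2) ^ (a-2) := Real.mul_rpow ht.le (by norm_num)
        have m : t ^ (a+b-2) = t ^ (a-2) * t ^ b := by
          rw [← Real.rpow_add ht]; ring_nf
        have X : 0 < τ ^ (a-1) * t ^ (b-1) := by positivity
        have Y : 0 < t ^ (a+b-2) := by positivity
        calc _ ≤ K * (τ ^ (a-1) / (1-a)) + L * (t ^ b / b) := by gcongr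
          _ = (1/2:ℝ) ^ (b-1) / (1-a) * (τ ^ (a-1) * t ^ (b-1))
              + (1/2:ℝ) ^ (a-2) / b * t ^ (a+b-2) := by
            rw [k1, l1, m]; ring
          _ ≤ _ := by nlinarith [mul_pos hA Y, mul_pos hB X]
end
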